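/- arXiv:2503.08832 — 2 statements merged into one kernel-verified Lean document; each statement's English description precedes it below -/
import Mathlib

section
/- Let V be a monoidal category closed on the right and admitting binary products. The assignment (X, Y) ↦ X × Y on objects, together with the morphisms Homᵣ(X, X') × Homᵣ(Y, Y') → Homᵣ(X × Y, X' × Y') obtained by transposition under the adjunction − ⊗ (X × Y) ⊣ Homᵣ(X × Y, −) from the composite (Homᵣ(X, X') × Homᵣ(Y, Y')) ⊗ (X × Y) --(p₁ ⊗ p₁, p₂ ⊗ p₂)--> (Homᵣ(X, X') ⊗ X) × (Homᵣ(Y, Y') ⊗ Y) --ev × ev--> X' × Y', define a V-enriched functor × : V_r × V_r → V_r; that is, these morphisms are compatible with the enriched identities and with the enriched composition of the product V-category V_r × V_r. Dually, if V is closed on the left, the analogous data define an anti V-functor × : V_l × V_l → V_l. -/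
universe v u w w'

open CategoryTheory MonoidalCategory Limits

noncomputable section

namespace PaperComma

variable {V : Type u} [Category.{v} V] [MonoidalCategory V]

/-- A *right closed* structure on a monoidal category `V`: for every object `Y`, the
functor `- ⊗ Y` admits a right adjoint `Homᵣ(Y, -)`. -/
structure RightClosed (V : Type u) [Category.{v} V] [MonoidalCategory V] where
  homr : V → V ⥤ V
  adj : ∀ Y : V, tensorRight Y ⊣ homr Y

/-- A *left closed* structure on a monoidal category `V`: for every object `X`, the
functor `X ⊗ -` admits a right adjoint `Homₗ(X, -)`. -/
structure LeftClosed (V : Type u) [Category.{v} V] [MonoidalCategory V] where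
  homl : V → V ⥤ V
  adj : ∀ X : V, tensorLeft X ⊣ homl X

namespace RightClosed

variable (R : RightClosed V)

/-- `Homᵣ(Y, Z)`. -/
def hr (Y Z : V) : V := (R.homr Y).obj Z

/-- Transposition under the adjunction `- ⊗ Y ⊣ Homᵣ(Y, -)`. -/
def curry {X Y Z : V} (f : X ⊗ Y ⟶ Z) : X ⟶ R.hr Y Z :=
  ((R.adj Y).homEquiv X Z) f

/-- Inverse transposition. -/
def uncurry {X Y Z : V} (g : X ⟶ R.hr Y Z) : X ⊗ Y ⟶ Z :=
  ((R.adj Y).homEquiv X Z).symm g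

/-- The evaluation morphism (counit) `Homᵣ(Y, Z) ⊗ Y ⟶ Z`. -/
def ev (Y Z : V) : R.hr Y Z ⊗ Y ⟶ Z :=
  (R.adj Y).counit.app Z

/-- The identity `I ⟶ Homᵣ(X, X)` of the `V`-category `V_r`. -/
def idr (X : V) : 𝟙_ V ⟶ R.hr X X :=
  R.curry (λ_ X).hom

/-- The composition `Homᵣ(Y, Z) ⊗ Homᵣ(X, Y) ⟶ Homᵣ(X, Z)` of the `V`-category `V_r`. -/
def compr (X Y Z : V) : R.hr Y Z ⊗ R.hr X Y ⟶ R.hr X Z :=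
  R.curry ((α_ (R.hr Y Z) (R.hr X Y) X).hom ≫ (R.hr Y Z ◁ R.ev X Y) ≫ R.ev Y Z)

/-- Contravariant action of `Homᵣ` in its first variable. -/
def pre {Y' Y : V} (f : Y' ⟶ Y) (Z : V) : R.hr Y Z ⟶ R.hr Y' Z :=
  R.curry ((R.hr Y Z ◁ f) ≫ R.ev Y Z)

end RightClosed

namespace LeftClosed

variable (L : LeftClosed V)

/-- `Homₗ(X, Z)`. -/
def hl (X Z : V) : V := (L.homl X).obj Z

/-- Transposition under the adjunction `X ⊗ - ⊣ Homₗ(X, -)`. -/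
def curry {X A B : V} (f : X ⊗ A ⟶ B) : A ⟶ L.hl X B :=
  ((L.adj X).homEquiv A B) f

/-- Inverse transposition. -/
def uncurry {X A B : V} (g : A ⟶ L.hl X B) : X ⊗ A ⟶ B :=
  ((L.adj X).homEquiv A B).symm g

/-- The evaluation morphism (counit) `X ⊗ Homₗ(X, Z) ⟶ Z`. -/
def ev (X Z : V) : X ⊗ L.hl X Z ⟶ Z :=
  (L.adj X).counit.app Z

/-- The identity `I ⟶ Homₗ(X, X)` of the anti `V`-category `V_l`. -/
def idl (X : V) : 𝟙_ V ⟶ L.hl X X :=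
  L.curry (ρ_ X).hom

/-- The composition `Homₗ(X, Y) ⊗ Homₗ(Y, Z) ⟶ Homₗ(X, Z)` of the anti `V`-category `V_l`. -/
def compl (X Y Z : V) : L.hl X Y ⊗ L.hl Y Z ⟶ L.hl X Z :=
  L.curry ((α_ X (L.hl X Y) (L.hl Y Z)).inv ≫ (L.ev X Y ▷ L.hl Y Z) ≫ L.ev Y Z)

/-- Contravariant action of `Homₗ` in its first variable. -/
def pre {X' X : V} (g : X' ⟶ X) (Z : V) : L.hl X Z ⟶ L.hl X' Z :=
  L.curry ((g ▷ L.hl X Z) ≫ L.ev X Z)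

end LeftClosed

section Projections

variable (hI : IsTerminal (𝟙_ V))

/-- The first projection `X ⊗ Y ⟶ X`, when the monoidal unit is terminal. -/
def pi1 (X Y : V) : X ⊗ Y ⟶ X := (X ◁ hI.from Y) ≫ (ρ_ X).hom

/-- The second projection `X ⊗ Y ⟶ Y`, when the monoidal unit is terminal. -/
def pi2 (X Y : V) : X ⊗ Y ⟶ Y := (hI.from X ▷ Y) ≫ (λ_ Y).hom

/-- The canonical morphism `π = (π₁, π₂) : X ⊗ Y ⟶ X ⨯ Y`. -/
def piMap [HasBinaryProducts V] (X Y : V) : X ⊗ Y ⟶ X ⨯ Y :=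
  prod.lift (pi1 hI X Y) (pi2 hI X Y)

end Projections

end PaperComma


namespace PaperComma

variable {V : Type u} [Category.{v} V] [MonoidalCategory V] [HasBinaryProducts V]

/-- The canonical morphism `(p₁ ⊗ p₁, p₂ ⊗ p₂) : (A ⨯ B) ⊗ (C ⨯ D) ⟶ (A ⊗ C) ⨯ (B ⊗ D)`. -/
def distrib (A B X Y : V) : (A ⨯ B) ⊗ (X ⨯ Y) ⟶ (A ⊗ X) ⨯ (B ⊗ Y) :=
  prod.lift (prod.fst ⊗ₘ prod.fst) (prod.snd ⊗ₘ prod.snd)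

/-- The structure morphism of the product `V`-functor `× : V_r × V_r ⟶ V_r` on homs:
`Homᵣ(X, X') ⨯ Homᵣ(Y, Y') ⟶ Homᵣ(X ⨯ Y, X' ⨯ Y')`, obtained by transposing
`(p₁ ⊗ p₁, p₂ ⊗ p₂)` followed by `ev ⨯ ev`. -/
def prodMapR (R : RightClosed V) (X X' Y Y' : V) :
    R.hr X X' ⨯ R.hr Y Y' ⟶ R.hr (X ⨯ Y) (X' ⨯ Y') :=
  R.curry (distrib (R.hr X X') (R.hr Y Y') X Y ≫ prod.map (R.ev X X') (R.ev Y Y'))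

/-- The structure morphism of the product anti `V`-functor `× : V_l × V_l ⟶ V_l` on homs:
`Homₗ(X, X') ⨯ Homₗ(Y, Y') ⟶ Homₗ(X ⨯ Y, X' ⨯ Y')`. -/
def prodMapL (L : LeftClosed V) (X X' Y Y' : V) :
    L.hl X X' ⨯ L.hl Y Y' ⟶ L.hl (X ⨯ Y) (X' ⨯ Y') :=
  L.curry (distrib X Y (L.hl X X') (L.hl Y Y') ≫ prod.map (L.ev X X') (L.ev Y Y'))

section Transposition

variable {C : Type u} [Category.{v} C] [MonoidalCategory C]

namespace RightClosed

variable (R : RightClosed C)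

theorem curry_whiskerRight_ev {X Y Z : C} (f : X ⊗ Y ⟶ Z) :
    R.curry f ▷ Y ≫ R.ev Y Z = f :=
  ((R.adj Y).homEquiv_counit (g := R.curry f)).symm.trans
    (((R.adj Y).homEquiv X Z).symm_apply_apply f)

theorem hom_ext {X Y Z : C} {f g : X ⟶ R.hr Y Z}
    (h : f ▷ Y ≫ R.ev Y Z = g ▷ Y ≫ R.ev Y Z) : f = g :=
  ((R.adj Y).homEquiv X Z).symm.injective <|
    ((R.adj Y).homEquiv_counit (g := f)).trans
      (h.trans ((R.adj Y).homEquiv_counit (g := g)).symm)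

theorem idr_whiskerRight_ev (X : C) : R.idr X ▷ X ≫ R.ev X X = (λ_ X).hom :=
  R.curry_whiskerRight_ev _

theorem compr_whiskerRight_ev (X Y Z : C) :
    R.compr X Y Z ▷ X ≫ R.ev X Z = (α_ _ _ _).hom ≫ R.hr Y Z ◁ R.ev X Y ≫ R.ev Y Z :=
  R.curry_whiskerRight_ev _

/-- The enriched identities are compatible with any morphism `p`. -/
theorem idr_ev_comp {P X : C} (p : P ⟶ X) :
    R.idr P ▷ P ≫ R.ev P P ≫ p = (R.idr X ⊗ₘ p) ≫ R.ev X X := by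
  rw [← Category.assoc, idr_whiskerRight_ev, MonoidalCategory.tensorHom_def', Category.assoc,
    idr_whiskerRight_ev, leftUnitor_naturality]

/-- If families of morphisms `m`, `h` and `m'`, `h'` are intertwined by `p`, `p'`, `p''`,
then so are their enriched composites. -/
theorem compr_ev_comp {A A' P P' P'' X X' X'' : C} {p : P ⟶ X} {p' : P' ⟶ X'}
    {p'' : P'' ⟶ X''} {m : A ⟶ R.hr P P'} {h : A ⟶ R.hr X X'}
    {m' : A' ⟶ R.hr P' P''} {h' : A' ⟶ R.hr X' X''}
    (w : m ▷ P ≫ R.ev P P' ≫ p' = (h ⊗ₘ p) ≫ R.ev X X')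
    (w' : m' ▷ P' ≫ R.ev P' P'' ≫ p'' = (h' ⊗ₘ p') ≫ R.ev X' X'') :
    ((m' ⊗ₘ m) ≫ R.compr P P' P'') ▷ P ≫ R.ev P P'' ≫ p'' =
      ((h' ⊗ₘ h) ≫ R.compr X X' X'' ⊗ₘ p) ≫ R.ev X X'' := by
  calc
    _ = (α_ A' A P).hom ≫ A' ◁ (m ▷ P ≫ R.ev P P') ≫ m' ▷ P' ≫ R.ev P' P'' ≫ p'' := by
      rw [comp_whiskerRight, Category.assoc, ← Category.assoc (R.compr P P' P'' ▷ P),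
        compr_whiskerRight_ev, ← tensorHom_id (m' ⊗ₘ m)]
      simp only [Category.assoc]
      rw [associator_naturality_assoc, tensorHom_id, MonoidalCategory.tensorHom_def',
        MonoidalCategory.whiskerLeft_comp]
      simp only [Category.assoc, whisker_exchange_assoc]
    _ = (α_ A' A P).hom ≫ A' ◁ (m ▷ P ≫ R.ev P P' ≫ p') ≫ h' ▷ X' ≫ R.ev X' X'' := by
      rw [w', MonoidalCategory.tensorHom_def']
      simp only [MonoidalCategory.whiskerLeft_comp, Category.assoc]
    _ = (α_ A' A P).hom ≫ (h' ⊗ₘ (h ⊗ₘ p)) ≫ R.hr X' X'' ◁ R.ev X X' ≫ R.ev X' X'' := by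
      rw [w, MonoidalCategory.tensorHom_def' h', MonoidalCategory.whiskerLeft_comp]
      simp only [Category.assoc, whisker_exchange_assoc]
    _ = _ := by
      rw [← associator_naturality_assoc, ← compr_whiskerRight_ev,
        MonoidalCategory.tensorHom_def' (_ ≫ _), comp_whiskerRight,
        MonoidalCategory.tensorHom_def' (h' ⊗ₘ h)]
      simp only [Category.assoc]

end RightClosed

namespace LeftClosed

variable (L : LeftClosed C)

theorem whiskerLeft_curry_ev {X A B : C} (f : X ⊗ A ⟶ B) :
    X ◁ L.curry f ≫ L.ev X B = f :=
  ((L.adj X).homEquiv_counit (g := L.curry f)).symm.trans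
    (((L.adj X).homEquiv A B).symm_apply_apply f)

theorem hom_ext {X A B : C} {f g : A ⟶ L.hl X B}
    (h : X ◁ f ≫ L.ev X B = X ◁ g ≫ L.ev X B) : f = g :=
  ((L.adj X).homEquiv A B).symm.injective <|
    ((L.adj X).homEquiv_counit (g := f)).trans
      (h.trans ((L.adj X).homEquiv_counit (g := g)).symm)

theorem whiskerLeft_idl_ev (X : C) : X ◁ L.idl X ≫ L.ev X X = (ρ_ X).hom :=
  L.whiskerLeft_curry_ev _

theorem whiskerLeft_compl_ev (X Y Z : C) :
    X ◁ L.compl X Y Z ≫ L.ev X Z = (α_ _ _ _).inv ≫ L.ev X Y ▷ L.hl Y Z ≫ L.ev Y Z :=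
  L.whiskerLeft_curry_ev _

/-- The enriched identities are compatible with any morphism `p`. -/
theorem idl_ev_comp {P X : C} (p : P ⟶ X) :
    P ◁ L.idl P ≫ L.ev P P ≫ p = (p ⊗ₘ L.idl X) ≫ L.ev X X := by
  rw [← Category.assoc, whiskerLeft_idl_ev, MonoidalCategory.tensorHom_def, Category.assoc,
    whiskerLeft_idl_ev, rightUnitor_naturality]

/-- If families of morphisms `m`, `h` and `m'`, `h'` are intertwined by `p`, `p'`, `p''`,
then so are their enriched composites. -/
theorem compl_ev_comp {A A' P P' P'' X X' X'' : C} {p : P ⟶ X} {p' : P' ⟶ X'}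
    {p'' : P'' ⟶ X''} {m : A ⟶ L.hl P P'} {h : A ⟶ L.hl X X'}
    {m' : A' ⟶ L.hl P' P''} {h' : A' ⟶ L.hl X' X''}
    (w : P ◁ m ≫ L.ev P P' ≫ p' = (p ⊗ₘ h) ≫ L.ev X X')
    (w' : P' ◁ m' ≫ L.ev P' P'' ≫ p'' = (p' ⊗ₘ h') ≫ L.ev X' X'') :
    P ◁ ((m ⊗ₘ m') ≫ L.compl P P' P'') ≫ L.ev P P'' ≫ p'' =
      (p ⊗ₘ (h ⊗ₘ h') ≫ L.compl X X' X'') ≫ L.ev X X'' := by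
  calc
    _ = (α_ P A A').inv ≫ (P ◁ m ≫ L.ev P P') ▷ A' ≫ P' ◁ m' ≫ L.ev P' P'' ≫ p'' := by
      rw [MonoidalCategory.whiskerLeft_comp, Category.assoc,
        ← Category.assoc (P ◁ L.compl P P' P''), whiskerLeft_compl_ev,
        ← id_tensorHom P (m ⊗ₘ m')]
      simp only [Category.assoc]
      rw [associator_inv_naturality_assoc, id_tensorHom, MonoidalCategory.tensorHom_def,
        comp_whiskerRight]
      simp only [Category.assoc, whisker_exchange_assoc]
    _ = (α_ P A A').inv ≫ (P ◁ m ≫ L.ev P P' ≫ p') ▷ A' ≫ X' ◁ h' ≫ L.ev X' X'' := by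
      rw [w', MonoidalCategory.tensorHom_def]
      simp only [comp_whiskerRight, Category.assoc]
    _ = (α_ P A A').inv ≫ ((p ⊗ₘ h) ⊗ₘ h') ≫ L.ev X X' ▷ L.hl X' X'' ≫ L.ev X' X'' := by
      rw [w, MonoidalCategory.tensorHom_def _ h', comp_whiskerRight]
      simp only [Category.assoc, whisker_exchange_assoc]
    _ = _ := by
      rw [← associator_inv_naturality_assoc, ← whiskerLeft_compl_ev,
        MonoidalCategory.tensorHom_def p (_ ≫ _), MonoidalCategory.whiskerLeft_comp,
        MonoidalCategory.tensorHom_def p (h ⊗ₘ h')]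
      simp only [Category.assoc]

end LeftClosed

end Transposition

theorem distrib_map_fst {A B X Y Z W : V} (f : A ⊗ X ⟶ Z) (g : B ⊗ Y ⟶ W) :
    (distrib A B X Y ≫ prod.map f g) ≫ prod.fst = (prod.fst ⊗ₘ prod.fst) ≫ f := by
  rw [Category.assoc, prod.map_fst, distrib, prod.lift_fst_assoc]

theorem distrib_map_snd {A B X Y Z W : V} (f : A ⊗ X ⟶ Z) (g : B ⊗ Y ⟶ W) :
    (distrib A B X Y ≫ prod.map f g) ≫ prod.snd = (prod.snd ⊗ₘ prod.snd) ≫ g := by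
  rw [Category.assoc, prod.map_snd, distrib, prod.lift_snd_assoc]

theorem prodMapR_ev_fst (R : RightClosed V) (X X' Y Y' : V) :
    prodMapR R X X' Y Y' ▷ (X ⨯ Y) ≫ R.ev _ _ ≫ prod.fst =
      (prod.fst ⊗ₘ prod.fst) ≫ R.ev X X' := by
  rw [← Category.assoc, prodMapR, R.curry_whiskerRight_ev, distrib_map_fst]

theorem prodMapR_ev_snd (R : RightClosed V) (X X' Y Y' : V) :
    prodMapR R X X' Y Y' ▷ (X ⨯ Y) ≫ R.ev _ _ ≫ prod.snd =
      (prod.snd ⊗ₘ prod.snd) ≫ R.ev Y Y' := by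
  rw [← Category.assoc, prodMapR, R.curry_whiskerRight_ev, distrib_map_snd]

/-- A morphism into `Homᵣ(X ⨯ Y, X' ⨯ Y')` factors through `prodMapR` as soon as its transpose
does so after both projections. -/
theorem comp_prodMapR_eq (R : RightClosed V) {A X X' Y Y' : V} (g : A ⟶ R.hr X X' ⨯ R.hr Y Y')
    (k : A ⟶ R.hr (X ⨯ Y) (X' ⨯ Y'))
    (h₁ : k ▷ (X ⨯ Y) ≫ R.ev _ _ ≫ prod.fst = (g ≫ prod.fst ⊗ₘ prod.fst) ≫ R.ev X X')
    (h₂ : k ▷ (X ⨯ Y) ≫ R.ev _ _ ≫ prod.snd = (g ≫ prod.snd ⊗ₘ prod.snd) ≫ R.ev Y Y') :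
    g ≫ prodMapR R X X' Y Y' = k := by
  apply R.hom_ext
  apply Limits.prod.hom_ext
  · rw [Category.assoc, Category.assoc, h₁, comp_whiskerRight, Category.assoc, prodMapR_ev_fst,
      whiskerRight_comp_tensorHom_assoc]
  · rw [Category.assoc, Category.assoc, h₂, comp_whiskerRight, Category.assoc, prodMapR_ev_snd,
      whiskerRight_comp_tensorHom_assoc]

theorem prodMapL_ev_fst (L : LeftClosed V) (X X' Y Y' : V) :
    (X ⨯ Y) ◁ prodMapL L X X' Y Y' ≫ L.ev _ _ ≫ prod.fst =
      (prod.fst ⊗ₘ prod.fst) ≫ L.ev X X' := by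
  rw [← Category.assoc, prodMapL, L.whiskerLeft_curry_ev, distrib_map_fst]

theorem prodMapL_ev_snd (L : LeftClosed V) (X X' Y Y' : V) :
    (X ⨯ Y) ◁ prodMapL L X X' Y Y' ≫ L.ev _ _ ≫ prod.snd =
      (prod.snd ⊗ₘ prod.snd) ≫ L.ev Y Y' := by
  rw [← Category.assoc, prodMapL, L.whiskerLeft_curry_ev, distrib_map_snd]

/-- A morphism into `Homₗ(X ⨯ Y, X' ⨯ Y')` factors through `prodMapL` as soon as its transpose
does so after both projections. -/
theorem comp_prodMapL_eq (L : LeftClosed V) {A X X' Y Y' : V} (g : A ⟶ L.hl X X' ⨯ L.hl Y Y')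
    (k : A ⟶ L.hl (X ⨯ Y) (X' ⨯ Y'))
    (h₁ : (X ⨯ Y) ◁ k ≫ L.ev _ _ ≫ prod.fst = (prod.fst ⊗ₘ g ≫ prod.fst) ≫ L.ev X X')
    (h₂ : (X ⨯ Y) ◁ k ≫ L.ev _ _ ≫ prod.snd = (prod.snd ⊗ₘ g ≫ prod.snd) ≫ L.ev Y Y') :
    g ≫ prodMapL L X X' Y Y' = k := by
  apply L.hom_ext
  apply Limits.prod.hom_ext
  · rw [Category.assoc, Category.assoc, h₁, MonoidalCategory.whiskerLeft_comp, Category.assoc,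
      prodMapL_ev_fst, whiskerLeft_comp_tensorHom_assoc]
  · rw [Category.assoc, Category.assoc, h₂, MonoidalCategory.whiskerLeft_comp, Category.assoc,
      prodMapL_ev_snd, whiskerLeft_comp_tensorHom_assoc]

/-- Let `V` be a monoidal category closed on the right, admitting binary
products. The assignment `(X, Y) ↦ X ⨯ Y` together with the morphisms `prodMapR` defines
a `V`-enriched functor `× : V_r × V_r ⟶ V_r`: the structure morphisms are compatible
with the enriched identities and the enriched composition of the product `V`-category
`V_r × V_r`. Dually, if `V` is closed on the left, the analogous data `prodMapL` defines
an anti `V`-functor `× : V_l × V_l ⟶ V_l`. -/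
theorem prod_enriched_functor (R : RightClosed V) (L : LeftClosed V) :
    -- compatibility with the enriched identities of `V_r × V_r`
    (∀ X Y : V,
      prod.lift (R.idr X) (R.idr Y) ≫ prodMapR R X X Y Y = R.idr (X ⨯ Y)) ∧
    -- compatibility with the enriched composition of `V_r × V_r`
    (∀ X X' X'' Y Y' Y'' : V,
      (distrib (R.hr X' X'') (R.hr Y' Y'') (R.hr X X') (R.hr Y Y')
          ≫ prod.map (R.compr X X' X'') (R.compr Y Y' Y''))
        ≫ prodMapR R X X'' Y Y''
      = (prodMapR R X' X'' Y' Y'' ⊗ₘ prodMapR R X X' Y Y')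
          ≫ R.compr (X ⨯ Y) (X' ⨯ Y') (X'' ⨯ Y'')) ∧
    -- compatibility with the enriched identities of `V_l × V_l`
    (∀ X Y : V,
      prod.lift (L.idl X) (L.idl Y) ≫ prodMapL L X X Y Y = L.idl (X ⨯ Y)) ∧
    -- compatibility with the (anti) enriched composition of `V_l × V_l`
    (∀ X X' X'' Y Y' Y'' : V,
      (distrib (L.hl X X') (L.hl Y Y') (L.hl X' X'') (L.hl Y' Y'')
          ≫ prod.map (L.compl X X' X'') (L.compl Y Y' Y''))
        ≫ prodMapL L X X'' Y Y''
      = (prodMapL L X X' Y Y' ⊗ₘ prodMapL L X' X'' Y' Y'')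
          ≫ L.compl (X ⨯ Y) (X' ⨯ Y') (X'' ⨯ Y'')) := by
  refine ⟨fun X Y => ?_, fun X X' X'' Y Y' Y'' => ?_, fun X Y => ?_,
    fun X X' X'' Y Y' Y'' => ?_⟩
  · apply comp_prodMapR_eq
    · rw [prod.lift_fst, R.idr_ev_comp]
    · rw [prod.lift_snd, R.idr_ev_comp]
  · apply comp_prodMapR_eq
    · rw [distrib_map_fst]
      exact R.compr_ev_comp (prodMapR_ev_fst ..) (prodMapR_ev_fst ..)
    · rw [distrib_map_snd]
      exact R.compr_ev_comp (prodMapR_ev_snd ..) (prodMapR_ev_snd ..)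
  · apply comp_prodMapL_eq
    · rw [prod.lift_fst, L.idl_ev_comp]
    · rw [prod.lift_snd, L.idl_ev_comp]
  · apply comp_prodMapL_eq
    · rw [distrib_map_fst]
      exact L.compl_ev_comp (prodMapL_ev_fst ..) (prodMapL_ev_fst ..)
    · rw [distrib_map_snd]
      exact L.compl_ev_comp (prodMapL_ev_snd ..) (prodMapL_ev_snd ..)

end PaperComma

end
end

section
/- Let V be a monoidal category with projections and with jointly surjective projections. For a category A enriched in the cartesian monoidal structure (V, ×), let ι(A) denote the (V, ⊗)-enriched category obtained by transporting the enrichment along the lax monoidal identity functor (V, ×) → (V, ⊗) with structure morphisms π (same objects and hom-objects, composition comp ∘ π, identities composed with the isomorphism I ≅ terminal object). Then: (i) ι is injective on objects, i.e., if ι(A) = ι(A') then A = A'; (ii) for (V, ×)-enriched categories A and B, an object map together with hom-morphisms Hom_A(a, a') → Hom_B(Fa, Fa') is a (V, ×)-enriched functor A → B if and only if the same data is a (V, ⊗)-enriched functor ι(A) → ι(B), so ι induces a bijection between (V, ×)-enriched functors A → B and (V, ⊗)-enriched functors ι(A) → ι(B); (iii) for (V, ×)-enriched functors F, G : A → B,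 a family of component morphisms is a (V, ×)-enriched natural transformation F → G if and only if the corresponding family is a (V, ⊗)-enriched natural transformation ι(F) → ι(G), so ι induces a bijection on enriched natural transformations as well. -/
universe v u w w'

open CategoryTheory MonoidalCategory Limits

noncomputable section

namespace PaperComma

variable {V : Type u} [Category.{v} V] [MonoidalCategory V]

section Transport

variable [HasFiniteProducts V] (hI : IsTerminal (𝟙_ V))

/-- A category enriched in the cartesian monoidal structure `(V, ×)` (with the terminal
unit chosen to be `I`, which is terminal). -/
structure CartEnriched (C : Type w) where
  Hom : C → C → V
  id : ∀ a : C, 𝟙_ V ⟶ Hom a a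
  comp : ∀ a b c : C, Hom b c ⨯ Hom a b ⟶ Hom a c
  id_comp : ∀ a b : C,
    prod.lift (hI.from (Hom a b) ≫ id b) (𝟙 (Hom a b)) ≫ comp a b b = 𝟙 (Hom a b)
  comp_id : ∀ a b : C,
    prod.lift (𝟙 (Hom a b)) (hI.from (Hom a b) ≫ id a) ≫ comp a a b = 𝟙 (Hom a b)
  assoc : ∀ a b c d : C,
    prod.map (comp b c d) (𝟙 (Hom a b)) ≫ comp a b d
      = (prod.associator (Hom c d) (Hom b c) (Hom a b)).hom
          ≫ prod.map (𝟙 (Hom c d)) (comp a b c) ≫ comp a c d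

/-- The data of a `(V, ⊗)`-enriched category (no axioms). -/
structure TensorEnrichedData (V : Type u) [Category.{v} V] [MonoidalCategory V]
    (C : Type w) where
  Hom : C → C → V
  id : ∀ a : C, 𝟙_ V ⟶ Hom a a
  comp : ∀ a b c : C, Hom b c ⊗ Hom a b ⟶ Hom a c

/-- The data of a `(V, ⊗)`-enriched category satisfies the enriched category axioms. -/
def TensorEnrichedData.IsVCat {C : Type w} (A : TensorEnrichedData V C) : Prop :=
  (∀ a b : C, (λ_ (A.Hom a b)).inv ≫ (A.id b ▷ A.Hom a b) ≫ A.comp a b b = 𝟙 (A.Hom a b)) ∧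
  (∀ a b : C, (ρ_ (A.Hom a b)).inv ≫ (A.Hom a b ◁ A.id a) ≫ A.comp a a b = 𝟙 (A.Hom a b)) ∧
  (∀ a b c d : C,
    (A.comp b c d ▷ A.Hom a b) ≫ A.comp a b d
      = (α_ (A.Hom c d) (A.Hom b c) (A.Hom a b)).hom
          ≫ (A.Hom c d ◁ A.comp a b c) ≫ A.comp a c d)

/-- Transport of a `(V, ×)`-category along the lax monoidal identity functor
`(V, ×) → (V, ⊗)` with structure morphisms `π`: same objects and hom-objects,
composition `π ≫ comp`, and the same identities (the unit constraint being `I ≅ I`). -/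
def iota {C : Type w} (A : CartEnriched hI C) : TensorEnrichedData V C where
  Hom := A.Hom
  id := A.id
  comp a b c := piMap hI (A.Hom b c) (A.Hom a b) ≫ A.comp a b c

/-- The given data is a `(V, ×)`-enriched functor. -/
def IsCartFunctor {C : Type w} {D : Type w'} (A : CartEnriched hI C)
    (B : CartEnriched hI D) (obj : C → D)
    (map : ∀ a a' : C, A.Hom a a' ⟶ B.Hom (obj a) (obj a')) : Prop :=
  (∀ a : C, A.id a ≫ map a a = B.id (obj a)) ∧
  (∀ a b c : C,
    A.comp a b c ≫ map a c
      = prod.map (map b c) (map a b) ≫ B.comp (obj a) (obj b) (obj c))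

/-- The given data is a `(V, ⊗)`-enriched functor. -/
def IsTensorFunctor {C : Type w} {D : Type w'} (A : TensorEnrichedData V C)
    (B : TensorEnrichedData V D) (obj : C → D)
    (map : ∀ a a' : C, A.Hom a a' ⟶ B.Hom (obj a) (obj a')) : Prop :=
  (∀ a : C, A.id a ≫ map a a = B.id (obj a)) ∧
  (∀ a b c : C,
    A.comp a b c ≫ map a c
      = (map b c ⊗ₘ map a b) ≫ B.comp (obj a) (obj b) (obj c))

/-- The given family is a `(V, ×)`-enriched natural transformation `F ⟶ G`. -/
def IsCartNatTrans {C : Type w} {D : Type w'} (A : CartEnriched hI C)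
    (B : CartEnriched hI D) (Fobj Gobj : C → D)
    (Fmap : ∀ a a' : C, A.Hom a a' ⟶ B.Hom (Fobj a) (Fobj a'))
    (Gmap : ∀ a a' : C, A.Hom a a' ⟶ B.Hom (Gobj a) (Gobj a'))
    (app : ∀ a : C, 𝟙_ V ⟶ B.Hom (Fobj a) (Gobj a)) : Prop :=
  ∀ a b : C,
    prod.lift (hI.from (A.Hom a b) ≫ app b) (Fmap a b)
        ≫ B.comp (Fobj a) (Fobj b) (Gobj b)
      = prod.lift (Gmap a b) (hI.from (A.Hom a b) ≫ app a)
          ≫ B.comp (Fobj a) (Gobj a) (Gobj b)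

/-- The given family is a `(V, ⊗)`-enriched natural transformation `F ⟶ G`. -/
def IsTensorNatTrans {C : Type w} {D : Type w'} (A : TensorEnrichedData V C)
    (B : TensorEnrichedData V D) (Fobj Gobj : C → D)
    (Fmap : ∀ a a' : C, A.Hom a a' ⟶ B.Hom (Fobj a) (Fobj a'))
    (Gmap : ∀ a a' : C, A.Hom a a' ⟶ B.Hom (Gobj a) (Gobj a'))
    (app : ∀ a : C, 𝟙_ V ⟶ B.Hom (Fobj a) (Gobj a)) : Prop :=
  ∀ a b : C,
    (λ_ (A.Hom a b)).inv ≫ (app b ⊗ₘ Fmap a b) ≫ B.comp (Fobj a) (Fobj b) (Gobj b)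
      = (ρ_ (A.Hom a b)).inv ≫ (Gmap a b ⊗ₘ app a) ≫ B.comp (Fobj a) (Gobj a) (Gobj b)

end Transport

section ProjectionLemmas

variable (hI : IsTerminal (𝟙_ V))

theorem tensorHom_pi1 {X X' Y Y' : V} (f : X ⟶ X') (g : Y ⟶ Y') :
    (f ⊗ₘ g) ≫ pi1 hI X' Y' = pi1 hI X Y ≫ f := by
  rw [pi1, pi1, MonoidalCategory.tensorHom_def', Category.assoc, Category.assoc,
    ← whisker_exchange_assoc, rightUnitor_naturality, ← whiskerLeft_comp_assoc,
    hI.hom_ext (g ≫ hI.from Y') (hI.from Y)]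

theorem tensorHom_pi2 {X X' Y Y' : V} (f : X ⟶ X') (g : Y ⟶ Y') :
    (f ⊗ₘ g) ≫ pi2 hI X' Y' = pi2 hI X Y ≫ g := by
  rw [pi2, pi2, MonoidalCategory.tensorHom_def, Category.assoc, Category.assoc,
    whisker_exchange_assoc, leftUnitor_naturality, ← comp_whiskerRight_assoc,
    hI.hom_ext (f ≫ hI.from X') (hI.from X)]

theorem leftUnitor_inv_pi2 (X : V) : (λ_ X).inv ≫ pi2 hI (𝟙_ V) X = 𝟙 X := by
  rw [pi2, hI.hom_ext (hI.from (𝟙_ V)) (𝟙 _), id_whiskerRight, Category.id_comp,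
    Iso.inv_hom_id]

theorem rightUnitor_inv_pi1 (X : V) : (ρ_ X).inv ≫ pi1 hI X (𝟙_ V) = 𝟙 X := by
  rw [pi1, hI.hom_ext (hI.from (𝟙_ V)) (𝟙 _), whiskerLeft_id, Category.id_comp,
    Iso.inv_hom_id]

theorem associator_hom_pi1 (X Y Z : V) :
    (α_ X Y Z).hom ≫ pi1 hI X (Y ⊗ Z) = pi1 hI (X ⊗ Y) Z ≫ pi1 hI X Y := by
  have h : hI.from (Y ⊗ Z) = (Y ◁ hI.from Z) ≫ (ρ_ Y).hom ≫ hI.from Y := hI.hom_ext _ _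
  simp only [pi1, h]
  monoidal

theorem associator_hom_pi2 (X Y Z : V) :
    (α_ X Y Z).hom ≫ pi2 hI X (Y ⊗ Z) = pi2 hI X Y ▷ Z := by
  simp only [pi2]
  monoidal

theorem whiskerRight_pi2_pi1 (X Y Z : V) :
    pi2 hI X Y ▷ Z ≫ pi1 hI Y Z = pi1 hI (X ⊗ Y) Z ≫ pi2 hI X Y := by
  rw [← MonoidalCategory.tensorHom_id, tensorHom_pi1]

theorem whiskerRight_pi2_pi2 (X Y Z : V) :
    pi2 hI X Y ▷ Z ≫ pi2 hI Y Z = pi2 hI (X ⊗ Y) Z := by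
  rw [← MonoidalCategory.tensorHom_id, tensorHom_pi2, Category.comp_id]

variable [HasBinaryProducts V]

theorem tensorHom_piMap {X X' Y Y' : V} (f : X ⟶ X') (g : Y ⟶ Y') :
    (f ⊗ₘ g) ≫ piMap hI X' Y' = piMap hI X Y ≫ prod.map f g := by
  simp only [piMap, prod.comp_lift, prod.lift_map, tensorHom_pi1, tensorHom_pi2]

theorem leftUnitor_inv_tensorHom_piMap {X Y Z : V} (f : 𝟙_ V ⟶ Y) (g : X ⟶ Z) :
    (λ_ X).inv ≫ (f ⊗ₘ g) ≫ piMap hI Y Z = prod.lift (hI.from X ≫ f) g := by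
  have h : (λ_ X).inv ≫ pi1 hI (𝟙_ V) X = hI.from X := hI.hom_ext _ _
  rw [tensorHom_piMap]
  simp only [piMap, prod.lift_map, prod.comp_lift, reassoc_of% h,
    reassoc_of% (leftUnitor_inv_pi2 hI X)]

theorem rightUnitor_inv_tensorHom_piMap {X Y Z : V} (f : X ⟶ Y) (g : 𝟙_ V ⟶ Z) :
    (ρ_ X).inv ≫ (f ⊗ₘ g) ≫ piMap hI Y Z = prod.lift f (hI.from X ≫ g) := by
  have h : (ρ_ X).inv ≫ pi2 hI X (𝟙_ V) = hI.from X := hI.hom_ext _ _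
  rw [tensorHom_piMap]
  simp only [piMap, prod.lift_map, prod.comp_lift, reassoc_of% h,
    reassoc_of% (rightUnitor_inv_pi1 hI X)]

/-- Compatibility of `π` with the associators of `⊗` and `×`. -/
theorem piMap_associator (X Y Z : V) :
    piMap hI (X ⊗ Y) Z ≫ prod.map (piMap hI X Y) (𝟙 Z) ≫ (prod.associator X Y Z).hom =
      (α_ X Y Z).hom ≫ piMap hI X (Y ⊗ Z) ≫ prod.map (𝟙 X) (piMap hI Y Z) := by
  ext <;>
  simp [piMap, associator_hom_pi1, reassoc_of% (associator_hom_pi2 hI X Y Z),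
    whiskerRight_pi2_pi1, whiskerRight_pi2_pi2, prod.lift_fst, prod.lift_snd,
    prod.lift_fst_assoc]

end ProjectionLemmas

section Transport

variable [HasFiniteProducts V] (hI : IsTerminal (𝟙_ V))

theorem iota_isVCat {C : Type w} (A : CartEnriched hI C) : (iota hI A).IsVCat := by
  refine ⟨fun a b => ?_, fun a b => ?_, fun a b c d => ?_⟩
  · have h := leftUnitor_inv_tensorHom_piMap hI (A.id b) (𝟙 (A.Hom a b))
    rw [MonoidalCategory.tensorHom_id] at h
    simp only [iota, reassoc_of% h, A.id_comp]
  · have h := rightUnitor_inv_tensorHom_piMap hI (𝟙 (A.Hom a b)) (A.id a)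
    rw [MonoidalCategory.id_tensorHom] at h
    simp only [iota, reassoc_of% h, A.comp_id]
  · have hl := tensorHom_piMap hI (A.comp b c d) (𝟙 (A.Hom a b))
    have hl' := tensorHom_piMap hI (piMap hI (A.Hom c d) (A.Hom b c)) (𝟙 (A.Hom a b))
    have hr := tensorHom_piMap hI (𝟙 (A.Hom c d)) (A.comp a b c)
    have hr' := tensorHom_piMap hI (𝟙 (A.Hom c d)) (piMap hI (A.Hom b c) (A.Hom a b))
    rw [MonoidalCategory.tensorHom_id] at hl hl'
    rw [MonoidalCategory.id_tensorHom] at hr hr'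
    have hα := piMap_associator hI (A.Hom c d) (A.Hom b c) (A.Hom a b)
    simp only [iota, comp_whiskerRight, whiskerLeft_comp, Category.assoc, reassoc_of% hl,
      reassoc_of% hl', reassoc_of% hr, reassoc_of% hr', A.assoc, reassoc_of% hα]

theorem iota_injective (hepi : ∀ X Y : V, Epi (piMap hI X Y)) (C : Type w) :
    Function.Injective (iota (V := V) hI (C := C)) := by
  rintro ⟨Hom, id, comp, _, _, _⟩ ⟨Hom', id', comp', _, _, _⟩ h
  simp only [iota, TensorEnrichedData.mk.injEq] at h
  obtain ⟨rfl, hid, hcomp⟩ := h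
  obtain rfl := eq_of_heq hid
  obtain rfl : comp = comp' := by
    funext a b c
    exact (cancel_epi (piMap hI (Hom b c) (Hom a b))).1
      (congrFun (congrFun (congrFun (eq_of_heq hcomp) a) b) c)
  rfl

theorem isCartFunctor_iff_isTensorFunctor (hepi : ∀ X Y : V, Epi (piMap hI X Y))
    {C : Type w} {D : Type w'} (A : CartEnriched hI C) (B : CartEnriched hI D) (obj : C → D)
    (map : ∀ a a' : C, A.Hom a a' ⟶ B.Hom (obj a) (obj a')) :
    IsCartFunctor hI A B obj map ↔ IsTensorFunctor (iota hI A) (iota hI B) obj map := by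
  refine and_congr Iff.rfl (forall₃_congr fun a b c => ?_)
  have h := tensorHom_piMap hI (map b c) (map a b)
  simp only [iota, Category.assoc, reassoc_of% h]
  exact (cancel_epi _).symm

theorem isCartNatTrans_iff_isTensorNatTrans {C : Type w} {D : Type w'}
    (A : CartEnriched hI C) (B : CartEnriched hI D) (Fobj Gobj : C → D)
    (Fmap : ∀ a a' : C, A.Hom a a' ⟶ B.Hom (Fobj a) (Fobj a'))
    (Gmap : ∀ a a' : C, A.Hom a a' ⟶ B.Hom (Gobj a) (Gobj a'))
    (app : ∀ a : C, 𝟙_ V ⟶ B.Hom (Fobj a) (Gobj a)) :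
    IsCartNatTrans hI A B Fobj Gobj Fmap Gmap app ↔
      IsTensorNatTrans (iota hI A) (iota hI B) Fobj Gobj Fmap Gmap app := by
  refine forall₂_congr fun a b => ?_
  have hl := leftUnitor_inv_tensorHom_piMap hI (app b) (Fmap a b)
  have hr := rightUnitor_inv_tensorHom_piMap hI (Gmap a b) (app a)
  simp only [iota, reassoc_of% hl, reassoc_of% hr]

/-- Let `V` be a monoidal category with projections and with jointly
surjective projections. The transport `ι` of `(V, ×)`-enriched categories along the lax
monoidal identity functor `(V, ×) → (V, ⊗)` produces `(V, ⊗)`-enriched categories, and: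
(i) `ι` is injective on objects; (ii) data is a `(V, ×)`-enriched functor iff it is a
`(V, ⊗)`-enriched functor between the transported categories, so `ι` induces a bijection
on enriched functors; (iii) a family of components is a `(V, ×)`-enriched natural
transformation iff it is a `(V, ⊗)`-enriched natural transformation, so `ι` induces a
bijection on enriched natural transformations. -/
theorem iota_injective_fullyFaithful
    (hepi : ∀ X Y : V, Epi (piMap hI X Y)) (C : Type w) (D : Type w') :
    -- the transported data satisfies the `(V, ⊗)`-enriched category axioms
    (∀ A : CartEnriched hI C, (iota hI A).IsVCat) ∧
    -- (i) injectivity on objects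
    (Function.Injective (iota (V := V) hI (C := C))) ∧
    -- (ii) bijection on enriched functors
    (∀ (A : CartEnriched hI C) (B : CartEnriched hI D) (obj : C → D)
        (map : ∀ a a' : C, A.Hom a a' ⟶ B.Hom (obj a) (obj a')),
      IsCartFunctor hI A B obj map ↔ IsTensorFunctor (iota hI A) (iota hI B) obj map) ∧
    -- (iii) bijection on enriched natural transformations
    (∀ (A : CartEnriched hI C) (B : CartEnriched hI D) (Fobj Gobj : C → D)
        (Fmap : ∀ a a' : C, A.Hom a a' ⟶ B.Hom (Fobj a) (Fobj a'))
        (Gmap : ∀ a a' : C, A.Hom a a' ⟶ B.Hom (Gobj a) (Gobj a'))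
        (app : ∀ a : C, 𝟙_ V ⟶ B.Hom (Fobj a) (Gobj a)),
      IsCartFunctor hI A B Fobj Fmap → IsCartFunctor hI A B Gobj Gmap →
        (IsCartNatTrans hI A B Fobj Gobj Fmap Gmap app ↔
          IsTensorNatTrans (iota hI A) (iota hI B) Fobj Gobj Fmap Gmap app)) :=
  ⟨iota_isVCat hI, iota_injective hI hepi C, isCartFunctor_iff_isTensorFunctor hI hepi,
    fun A B Fobj Gobj Fmap Gmap app _ _ =>
      isCartNatTrans_iff_isTensorNatTrans hI A B Fobj Gobj Fmap Gmap app⟩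

end Transport

end PaperComma

end
end
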